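/- Let F ∈ ℂ[X₀,…,X₄] be a homogeneous polynomial of degree 3 and suppose there exists a nonzero vector w = (w₀,…,w₄) ∈ ℂ⁵ such that the directional derivative ∑ᵢ wᵢ·∂F/∂Xᵢ is the zero polynomial (i.e., F is, up to a linear change of coordinates, a cubic form in at most 4 variables, so that the cubic threefold X = {F=0} ⊂ ℙ⁴ is a cone over a cubic hypersurface in ℙʳ, r ≤ 3). Then there exists a 6×6 matrix M of homogeneous linear forms in X₀,…,X₄ with Mᵀ = −M and det M = F². -/

import Mathlib

open MvPolynomial Matrix

/-- Pfaffian representability. -/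
def IsPf {σ : Type*} (F : MvPolynomial σ ℂ) : Prop :=
  ∃ M : Matrix (Fin 6) (Fin 6) (MvPolynomial σ ℂ),
      (∀ i j, (M i j).IsHomogeneous 1) ∧ Mᵀ = -M ∧ M.det = F ^ 2

set_option maxHeartbeats 4000000 in
theorem pf_det {R : Type*} [CommRing R] (x y z w a b c d e : R) :
   (!![0, x, 0, z, z, a; -x, 0, -w, 0, -w, b; 0, w, 0, y, w, c; -z, 0, -y, 0, -z, d; -z, w, -w, z, 0, e; -a, -b, -c, -d, -e, 0] : Matrix (Fin 6) (Fin 6) R).det = (e*(x*y-z*w) - d * (x*w-z*w) + c*(z*w-x*z) - b*(y*z-z*w) + a*(z*w-w*y))^2 := by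
  simp [Matrix.det_succ_row_zero, Fin.sum_univ_succ, Fin.succAbove]
  ring
set_option maxHeartbeats 4000000 in
theorem pf_det2 {R : Type*} [CommRing R] (l a b c d e f : R) :
   (!![0, l, 0, 0, 0, 0; -l, 0, 0, 0, 0, 0; 0, 0, 0, a, c, e; 0,0,-a,0,f,-d; 0,0,-c,-f,0,b;0,0,-e,d,-b,0] : Matrix (Fin 6) (Fin 6) R).det = (l*(a*b+c*d+e*f))^2 := by
  simp [Matrix.det_succ_row_zero, Fin.sum_univ_succ, Fin.succAbove]
  ring

theorem isPf_five {σ : Type*} {x y z w a b c d e : MvPolynomial σ ℂ}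
    (hx : x.IsHomogeneous 1) (hy : y.IsHomogeneous 1) (hz : z.IsHomogeneous 1)
    (hw : w.IsHomogeneous 1) (ha : a.IsHomogeneous 1) (hb : b.IsHomogeneous 1)
    (hc : c.IsHomogeneous 1) (hd : d.IsHomogeneous 1) (he : e.IsHomogeneous 1) :
    IsPf (e*(x*y-z*w) - d * (x*w-z*w) + c*(z*w-x*z) - b*(y*z-z*w) + a*(z*w-w*y)) := by
  refine ⟨_, ?_, ?_, pf_det x y z w a b c d e⟩
  · have h0 := isHomogeneous_zero σ ℂ 1
    intro i j
    fin_cases i <;> fin_cases j <;> first | assumption | exact IsHomogeneous.neg (by assumption)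
  · ext1 i j
    fin_cases i <;> fin_cases j <;> simp

theorem isPf_quad {σ : Type*} {l a b c d e f : MvPolynomial σ ℂ}
    (hl : l.IsHomogeneous 1) (ha : a.IsHomogeneous 1) (hb : b.IsHomogeneous 1)
    (hc : c.IsHomogeneous 1) (hd : d.IsHomogeneous 1) (he : e.IsHomogeneous 1)
    (hf : f.IsHomogeneous 1) :
    IsPf (l*(a*b+c*d+e*f)) := by
  refine ⟨_, ?_, ?_, pf_det2 l a b c d e f⟩
  · have h0 := isHomogeneous_zero σ ℂ 1
    intro i j
    fin_cases i <;> fin_cases j <;> first | assumption | exact IsHomogeneous.neg (by assumption)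
  · ext1 i j
    fin_cases i <;> fin_cases j <;> simp

theorem IsPf.aeval {σ τ : Type*} {F : MvPolynomial σ ℂ} (h : IsPf F)
    (g : σ → MvPolynomial τ ℂ) (hg : ∀ i, (g i).IsHomogeneous 1) :
    IsPf (MvPolynomial.aeval g F) := by
  obtain ⟨M, h1, h2, h3⟩ := h
  refine ⟨M.map (MvPolynomial.aeval g), ?_, ?_, ?_⟩
  · intro i j
    simpa using (h1 i j).aeval g hg
  · rw [← Matrix.transpose_map, h2]
    ext1 i j
    simp
  · have := (MvPolynomial.aeval (R := ℂ) g).map_det M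
    rw [h3, map_pow] at this
    rw [this]; rfl

/-- A linear form in four variables. -/
noncomputable def lin4 (a b c d : ℂ) : MvPolynomial (Fin 4) ℂ :=
  C a * X 0 + C b * X 1 + C c * X 2 + C d * X 3

theorem lin4_hom (a b c d : ℂ) : (lin4 a b c d).IsHomogeneous 1 :=
  (((isHomogeneous_C_mul_X a 0).add (isHomogeneous_C_mul_X b 1)).add
    (isHomogeneous_C_mul_X c 2)).add (isHomogeneous_C_mul_X d 3)

theorem hom_step {n : ℕ} {G : MvPolynomial (Fin 4) ℂ} (hG : G.IsHomogeneous (n + 1)) :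
    ∃ H : Fin 4 → MvPolynomial (Fin 4) ℂ, (∀ i, (H i).IsHomogeneous n) ∧
      G = ∑ i, X i * H i := by
  refine ⟨fun i => C (((n + 1 : ℕ) : ℂ)⁻¹) * pderiv i G, fun i => (hG.pderiv).C_mul _, ?_⟩
  have h := hG.sum_X_mul_pderiv
  have : ∑ i, X i * (C (((n + 1 : ℕ) : ℂ)⁻¹) * pderiv i G)
      = C (((n + 1 : ℕ) : ℂ)⁻¹) * ∑ i, X i * pderiv i G := by
    rw [Finset.mul_sum]
    exact Finset.sum_congr rfl fun i _ => by ring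
  rw [this, h, nsmul_eq_mul, ← mul_assoc, ← map_natCast (C : ℂ →+* MvPolynomial (Fin 4) ℂ),
    ← C_mul, inv_mul_cancel₀ (by exact_mod_cast Nat.succ_ne_zero n), C_1, one_mul]

theorem hom_one {G : MvPolynomial (Fin 4) ℂ} (hG : G.IsHomogeneous 1) :
    ∃ a b c d : ℂ, G = lin4 a b c d := by
  obtain ⟨H, hH, h⟩ := hom_step hG
  have : ∀ i, ∃ r, H i = C r := fun i =>
    ⟨_, (totalDegree_eq_zero_iff_eq_C).mp (Nat.le_zero.mp (hH i).totalDegree_le)⟩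
  choose r hr using this
  refine ⟨r 0, r 1, r 2, r 3, ?_⟩
  rw [h, Fin.sum_univ_four]
  simp only [hr, lin4]
  ring

theorem hom_two {G : MvPolynomial (Fin 4) ℂ} (hG : G.IsHomogeneous 2) :
    ∃ (a b c : ℂ) (m n : MvPolynomial (Fin 4) ℂ), m.IsHomogeneous 1 ∧ n.IsHomogeneous 1 ∧
      G = (C a * X 0 ^ 2 + C b * (X 0 * X 1) + C c * X 1 ^ 2) + X 2 * m + X 3 * n := by
  obtain ⟨H, hH, h⟩ := hom_step hG
  choose a b c d hr using fun i => hom_one (hH i)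
  refine ⟨a 0, b 0 + a 1, b 1, H 2 + lin4 (c 0) (c 1) 0 0, H 3 + lin4 (d 0) (d 1) 0 0,
    (hH _).add (lin4_hom ..), (hH _).add (lin4_hom ..), ?_⟩
  rw [h, Fin.sum_univ_four, hr 0, hr 1]
  simp only [lin4, C_add, C_0]
  ring

theorem binary_quad (a b c : ℂ) : ∃ p q : MvPolynomial (Fin 4) ℂ,
    p.IsHomogeneous 1 ∧ q.IsHomogeneous 1 ∧
      C a * X 0 ^ 2 + C b * (X 0 * X 1) + C c * X 1 ^ 2 = p * q := by
  by_cases ha : a = 0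
  · refine ⟨lin4 0 1 0 0, lin4 b c 0 0, lin4_hom .., lin4_hom .., ?_⟩
    subst ha
    simp only [lin4, C_0, C_1]
    ring
  · obtain ⟨s, hs⟩ := IsAlgClosed.exists_pow_nat_eq (b ^ 2 - 4 * a * c) (n := 2) (by norm_num)
    refine ⟨lin4 a ((b + s) / 2) 0 0, lin4 1 ((b - s) / (2 * a)) 0 0,
      lin4_hom .., lin4_hom .., ?_⟩
    have h1 : b = a * ((b - s) / (2 * a)) + (b + s) / 2 := by field_simp; ring
    have h2 : c = (b + s) / 2 * ((b - s) / (2 * a)) := by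
      field_simp
      linear_combination hs
    simp only [lin4, C_0, C_1]
    have h1' := congrArg (C : ℂ → MvPolynomial (Fin 4) ℂ) h1
    have h2' := congrArg (C : ℂ → MvPolynomial (Fin 4) ℂ) h2
    rw [C_add, C_mul] at h1'
    rw [C_mul] at h2'
    linear_combination (X 0 * X 1) * h1' + X 1 ^ 2 * h2'

theorem isPf_of_dvd {G l : MvPolynomial (Fin 4) ℂ} (hG : G.IsHomogeneous 3)
    (hl : l.IsHomogeneous 1) (h : l ∣ G) : IsPf G := by
  classical
  obtain ⟨q, rfl⟩ := h
  obtain ⟨q', hq', he⟩ : ∃ q' : MvPolynomial (Fin 4) ℂ, q'.IsHomogeneous 2 ∧ l * q = l * q' := by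
    let _ : GradedAlgebra (homogeneousSubmodule (Fin 4) ℂ) := MvPolynomial.gradedAlgebra
    refine ⟨DirectSum.decompose (homogeneousSubmodule (Fin 4) ℂ) q 2, 
      (DirectSum.decompose (homogeneousSubmodule (Fin 4) ℂ) q 2).2, ?_⟩
    have h1 := DirectSum.coe_decompose_mul_add_of_left_mem
      (homogeneousSubmodule (Fin 4) ℂ) (i := 1) (j := 2) (a := l) (b := q) hl
    have h2 : DirectSum.decompose (homogeneousSubmodule (Fin 4) ℂ) (l * q) (1 + 2) = l * q :=
      DirectSum.decompose_of_mem_same _ hG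
    rw [h2] at h1
    exact h1
  rw [he]
  obtain ⟨a, b, c, m, n, hm, hn, e⟩ := hom_two hq'
  obtain ⟨p, r, hp, hr, e2⟩ := binary_quad a b c
  rw [e, e2]
  exact isPf_quad hl hp hr (isHomogeneous_X _ _) hm (isHomogeneous_X _ _) hn

theorem isPf_of_points {G : MvPolynomial (Fin 4) ℂ} (hG : G.IsHomogeneous 3)
    (h : ∀ i, eval (Pi.single i 1) G = 0) (h1 : eval (fun _ => 1) G = 0) : IsPf G := by
  obtain ⟨H, hH, e⟩ := hom_step hG
  choose K hK e2 using fun i => hom_step (hH i)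
  choose a b c d hr using fun i j => hom_one (hK i j)
  obtain ⟨kxxy, h_kxxy⟩ : ∃ t, t = b 0 0 + a 0 1 + a 1 0 := ⟨_, rfl⟩
  obtain ⟨kxxz, h_kxxz⟩ : ∃ t, t = c 0 0 + a 0 2 + a 2 0 := ⟨_, rfl⟩
  obtain ⟨kxxw, h_kxxw⟩ : ∃ t, t = d 0 0 + a 0 3 + a 3 0 := ⟨_, rfl⟩
  obtain ⟨kxyy, h_kxyy⟩ : ∃ t, t = b 0 1 + b 1 0 + a 1 1 := ⟨_, rfl⟩
  obtain ⟨kxyz, h_kxyz⟩ : ∃ t, t = c 0 1 + b 0 2 + c 1 0 + a 1 2 + b 2 0 + a 2 1 := ⟨_, rfl⟩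
  obtain ⟨kxyw, h_kxyw⟩ : ∃ t, t = d 0 1 + b 0 3 + d 1 0 + a 1 3 + b 3 0 + a 3 1 := ⟨_, rfl⟩
  obtain ⟨kxzz, h_kxzz⟩ : ∃ t, t = c 0 2 + c 2 0 + a 2 2 := ⟨_, rfl⟩
  obtain ⟨kxzw, h_kxzw⟩ : ∃ t, t = d 0 2 + c 0 3 + d 2 0 + a 2 3 + c 3 0 + a 3 2 := ⟨_, rfl⟩
  obtain ⟨kxww, h_kxww⟩ : ∃ t, t = d 0 3 + d 3 0 + a 3 3 := ⟨_, rfl⟩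
  obtain ⟨kyyz, h_kyyz⟩ : ∃ t, t = c 1 1 + b 1 2 + b 2 1 := ⟨_, rfl⟩
  obtain ⟨kyyw, h_kyyw⟩ : ∃ t, t = d 1 1 + b 1 3 + b 3 1 := ⟨_, rfl⟩
  obtain ⟨kyzz, h_kyzz⟩ : ∃ t, t = c 1 2 + c 2 1 + b 2 2 := ⟨_, rfl⟩
  obtain ⟨kyzw, h_kyzw⟩ : ∃ t, t = d 1 2 + c 1 3 + d 2 1 + b 2 3 + c 3 1 + b 3 2 := ⟨_, rfl⟩
  obtain ⟨kyww, h_kyww⟩ : ∃ t, t = d 1 3 + d 3 1 + b 3 3 := ⟨_, rfl⟩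
  obtain ⟨kzzw, h_kzzw⟩ : ∃ t, t = d 2 2 + c 2 3 + c 3 2 := ⟨_, rfl⟩
  obtain ⟨kzww, h_kzww⟩ : ∃ t, t = d 2 3 + d 3 2 + c 3 3 := ⟨_, rfl⟩
  have key : G = C (a 0 0) * X 0 ^ 3 + C (b 1 1) * X 1 ^ 3 + C (c 2 2) * X 2 ^ 3
      + C (d 3 3) * X 3 ^ 3
      + C kxxy * (X 0 * X 0 * X 1)
      + C kxxz * (X 0 * X 0 * X 2)
      + C kxxw * (X 0 * X 0 * X 3)
      + C kxyy * (X 0 * X 1 * X 1)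
      + C kxyz * (X 0 * X 1 * X 2)
      + C kxyw * (X 0 * X 1 * X 3)
      + C kxzz * (X 0 * X 2 * X 2)
      + C kxzw * (X 0 * X 2 * X 3)
      + C kxww * (X 0 * X 3 * X 3)
      + C kyyz * (X 1 * X 1 * X 2)
      + C kyyw * (X 1 * X 1 * X 3)
      + C kyzz * (X 1 * X 2 * X 2)
      + C kyzw * (X 1 * X 2 * X 3)
      + C kyww * (X 1 * X 3 * X 3)
      + C kzzw * (X 2 * X 2 * X 3)
      + C kzww * (X 2 * X 3 * X 3) := by
    rw [e]
    simp only [Fin.sum_univ_four, e2, hr, lin4, C_add, h_kxxy, h_kxxz, h_kxxw, h_kxyy, h_kxyz, h_kxyw, h_kxzz, h_kxzw, h_kxww, h_kyyz, h_kyyw, h_kyzz, h_kyzw, h_kyww, h_kzzw, h_kzww]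
    ring
  have k0 : a 0 0 = 0 := by
    have := h 0
    rw [key] at this
    simpa [Pi.single_apply] using this
  have k1 : b 1 1 = 0 := by
    have := h 1
    rw [key] at this
    simpa [Pi.single_apply] using this
  have k2 : c 2 2 = 0 := by
    have := h 2
    rw [key] at this
    simpa [Pi.single_apply] using this
  have k3 : d 3 3 = 0 := by
    have := h 3
    rw [key] at this
    simpa [Pi.single_apply] using this
  have ks : kxxy + kxxz + kxxw + kxyy + kxyz + kxyw + kxzz + kxzw + kxww + kyyz + kyyw + kyzz + kyzw + kyww + kzzw + kzww = 0 := by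
    rw [key] at h1
    simpa [k0, k1, k2, k3] using h1
  have ks' := congrArg (C : ℂ → MvPolynomial (Fin 4) ℂ) ks
  simp only [C_add, C_0] at ks'
  have P := isPf_five (isHomogeneous_X ℂ (0 : Fin 4)) (isHomogeneous_X ℂ 1)
    (isHomogeneous_X ℂ 2) (isHomogeneous_X ℂ 3)
    (lin4_hom 0 (-kyyw) 0 (-kyww))
    (lin4_hom 0 (-kyyz) (-kyzz) (-(kxyy + kyyz + kyyw + kyzw)))
    (lin4_hom (-kxxz) 0 (-kxzz)
      (-(kxxy + kxxz + kxxw + kxzz + kyzz + kzzw + kxyz + kxzw)))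
    (lin4_hom (-kxxw) 0 (kxzz + kyzz + kzzw + kxyz) (-kxww))
    (lin4_hom kxxy kxyy kxyz kxyw)
  simp only [lin4, C_add, C_neg, C_0] at P
  convert P using 1
  rw [key, k0, k1, k2, k3]
  simp only [C_0]
  linear_combination (X 2 * X 3 ^ 2) * ks'

theorem irred_lin {l : MvPolynomial (Fin 4) ℂ} (hl : l.IsHomogeneous 1) (h0 : l ≠ 0) :
    Irreducible l := by
  refine irreducible_of_totalDegree_eq_one (hl.totalDegree h0) fun x hx => ?_
  rw [isUnit_iff_ne_zero]
  rintro rfl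
  apply h0
  ext i
  simpa using hx i

theorem exists_point {G : MvPolynomial (Fin 4) ℂ} (hG : G.IsHomogeneous 3)
    (hnd : ∀ l : MvPolynomial (Fin 4) ℂ, l.IsHomogeneous 1 → l ≠ 0 → ¬ l ∣ G)
    (L : Fin 4 → MvPolynomial (Fin 4) ℂ) (hL : ∀ i, (L i).IsHomogeneous 1)
    (hL0 : ∀ i, L i ≠ 0) :
    ∃ p : Fin 4 → ℂ, eval p G = 0 ∧ ∀ i, eval p (L i) ≠ 0 := by
  by_contra! hcon
  have hmem : (∏ i, L i) ∈ vanishingIdeal ℂ (zeroLocus ℂ (Ideal.span {G})) := by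
    rw [mem_vanishingIdeal_iff]
    intro p hp
    rw [zeroLocus_span] at hp
    have hp' : eval p G = 0 := by simpa [coe_aeval_eq_eval] using hp
    obtain ⟨i, hi⟩ := hcon p hp'
    have : eval p (∏ i, L i) = 0 := by
      rw [map_prod]
      exact Finset.prod_eq_zero (Finset.mem_univ i) hi
    simpa [coe_aeval_eq_eval] using this
  rw [vanishingIdeal_zeroLocus_eq_radical] at hmem
  obtain ⟨n, hn⟩ := hmem
  rw [Ideal.mem_span_singleton] at hn
  have hG0 : G ≠ 0 := by
    rintro rfl
    exact hnd (X 0) (isHomogeneous_X _ _) (X_ne_zero _) (dvd_zero _)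
  have hGu : ¬ IsUnit G := by
    intro hu
    have := (MvPolynomial.isUnit_iff_totalDegree_of_isReduced.mp hu).2
    rw [hG.totalDegree hG0] at this
    omega
  obtain ⟨r, hr, hrG⟩ := WfDvdMonoid.exists_irreducible_factor hGu hG0
  have hp : Prime r := hr.prime
  have h1 := hp.dvd_of_dvd_pow (hrG.trans hn)
  obtain ⟨i, -, hi⟩ := hp.exists_mem_finset_dvd h1
  have hass := hr.associated_of_dvd (irred_lin (hL i) (hL0 i)) hi
  exact hnd (L i) (hL i) (hL0 i) (hass.symm.dvd.trans hrG)

/-- The linear form of a functional. -/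
noncomputable def dualForm (φ : (Fin 4 → ℂ) →ₗ[ℂ] ℂ) : MvPolynomial (Fin 4) ℂ :=
  ∑ i, C (φ (Pi.single i 1)) * X i

theorem dualForm_hom (φ : (Fin 4 → ℂ) →ₗ[ℂ] ℂ) : (dualForm φ).IsHomogeneous 1 :=
  IsHomogeneous.sum _ _ _ fun _ _ => isHomogeneous_C_mul_X _ _

theorem eval_dualForm (φ : (Fin 4 → ℂ) →ₗ[ℂ] ℂ) (p : Fin 4 → ℂ) :
    eval p (dualForm φ) = φ p := by
  conv_rhs => rw [pi_eq_sum_univ' p, map_sum]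
  simp only [dualForm, map_sum, map_mul, eval_C, eval_X, map_smul, smul_eq_mul]
  refine Finset.sum_congr rfl fun i _ => ?_
  rw [mul_comm]

theorem dualForm_ne {φ : (Fin 4 → ℂ) →ₗ[ℂ] ℂ} (h : φ ≠ 0) : dualForm φ ≠ 0 := by
  intro h0
  apply h
  ext1 i
  ext
  simp [← eval_dualForm, h0]

theorem eval_smul_hom {G : MvPolynomial (Fin 4) ℂ} {n : ℕ} (hG : G.IsHomogeneous n) (c : ℂ)
    (p : Fin 4 → ℂ) (h : eval p G = 0) : eval (c • p) G = 0 := by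
  rw [eval_eq] at h ⊢
  have : ∀ d ∈ G.support, coeff d G * ∏ i ∈ d.support, (c • p) i ^ d i
      = c ^ n * (coeff d G * ∏ i ∈ d.support, p i ^ d i) := by
    intro d hd
    have := hG.degree_eq_sum_deg_support hd
    simp only [Pi.smul_apply, smul_eq_mul, mul_pow, Finset.prod_mul_distrib]
    rw [Finset.prod_pow_eq_pow_sum]
    have e : ∑ i ∈ d.support, d i = n := by rw [← this]
    rw [e]; ring
  rw [Finset.sum_congr rfl this, ← Finset.mul_sum, h, mul_zero]

theorem isPf_four {G : MvPolynomial (Fin 4) ℂ} (hG : G.IsHomogeneous 3) : IsPf G := by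
  by_cases hd : ∃ l : MvPolynomial (Fin 4) ℂ, l.IsHomogeneous 1 ∧ l ≠ 0 ∧ l ∣ G
  · obtain ⟨l, hl, -, h⟩ := hd
    exact isPf_of_dvd hG hl h
  have hnd : ∀ l : MvPolynomial (Fin 4) ℂ, l.IsHomogeneous 1 → l ≠ 0 → ¬ l ∣ G :=
    fun l h1 h2 h3 => hd ⟨l, h1, h2, h3⟩
  have hspan : ⊤ ≤ Submodule.span ℂ {p : Fin 4 → ℂ | eval p G = 0} := by
    by_contra hlt
    have hlt' : Submodule.span ℂ {p : Fin 4 → ℂ | eval p G = 0} < ⊤ :=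
      lt_top_iff_ne_top.mpr fun h => hlt h.ge
    obtain ⟨φ, hφ, hk⟩ := Submodule.exists_le_ker_of_lt_top _ hlt'
    obtain ⟨p, hp, hp2⟩ := exists_point hG hnd (fun _ => dualForm φ) (fun _ => dualForm_hom φ)
      (fun _ => dualForm_ne hφ)
    apply hp2 0
    rw [eval_dualForm]
    exact hk (Submodule.subset_span hp)
  obtain ⟨b, hb⟩ : ∃ b : Module.Basis (Fin 4) ℂ (Fin 4 → ℂ), ∀ i, eval (b i) G = 0 := by
    let b0 := Module.Basis.ofSpan hspan
    let e := b0.indexEquiv (Pi.basisFun ℂ (Fin 4))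
    refine ⟨b0.reindex e, fun i => ?_⟩
    have := Module.Basis.ofSpan_subset hspan (Set.mem_range_self (e.symm i))
    simpa [b0] using this
  obtain ⟨p, hp, hp2⟩ := exists_point hG hnd (fun i => dualForm (b.coord i))
    (fun _ => dualForm_hom _) (fun i => dualForm_ne (by
      intro h
      have := congrArg (fun f => f (b i)) h
      simp at this))
  simp only [eval_dualForm] at hp2
  have hps : p = ∑ j, b.coord j p • b j := (b.sum_repr p).symm
  let g : Fin 4 → MvPolynomial (Fin 4) ℂ := fun i => ∑ j, C (b.coord j p * b j i) * X j
  have hg : ∀ y, (fun i => eval y (g i)) = ∑ j, y j • b.coord j p • b j := by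
    intro y
    ext i
    simp only [g, map_sum, map_mul, eval_C, eval_X, Finset.sum_apply, Pi.smul_apply, smul_eq_mul]
    exact Finset.sum_congr rfl fun j _ => by ring
  have hev : ∀ y, eval y (MvPolynomial.aeval g G) = eval (∑ j, y j • b.coord j p • b j) G := by
    intro y
    rw [← hg y, ← coe_aeval_eq_eval, ← coe_aeval_eq_eval, RingHom.coe_coe, RingHom.coe_coe,
      ← AlgHom.comp_apply, comp_aeval]
  have hH : IsPf (MvPolynomial.aeval g G) := by
    apply isPf_of_points
    · simpa using hG.aeval g
        (fun i => IsHomogeneous.sum _ _ _ fun _ _ => isHomogeneous_C_mul_X _ _)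
    · intro i
      rw [hev, Finset.sum_eq_single i]
      · simpa using eval_smul_hom hG _ _ (hb i)
      · intro j _ hj
        simp [hj]
      · simp
    · rw [hev]
      simp only [one_smul]
      rw [← hps]; exact hp
  have := hH.aeval (fun j => dualForm ((b.coord j p)⁻¹ • b.coord j)) fun j => dualForm_hom _
  convert this using 1
  refine MvPolynomial.funext fun x => ?_
  have e1 : eval x (MvPolynomial.aeval (fun j => dualForm ((b.coord j p)⁻¹ • b.coord j))
      (MvPolynomial.aeval g G)) = eval (fun j => eval x (dualForm ((b.coord j p)⁻¹ • b.coord j)))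
      (MvPolynomial.aeval g G) := by
    rw [← coe_aeval_eq_eval, ← coe_aeval_eq_eval, RingHom.coe_coe, RingHom.coe_coe,
      ← AlgHom.comp_apply, comp_aeval]
  rw [e1, hev]
  congr 2
  conv_lhs => rw [← b.sum_repr x]
  refine Finset.sum_congr rfl fun j _ => ?_
  rw [eval_dualForm, smul_smul]
  congr 1
  have := hp2 j
  simp only [LinearMap.smul_apply, smul_eq_mul, Module.Basis.coord_apply] at this ⊢
  field_simp

theorem deriv_aeval (g : Fin 5 → Polynomial ℂ) (F : MvPolynomial (Fin 5) ℂ) :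
    Polynomial.derivative (MvPolynomial.aeval g F)
      = ∑ i, MvPolynomial.aeval g (pderiv i F) * Polynomial.derivative (g i) := by
  induction F using MvPolynomial.induction_on with
  | C a => simp [Polynomial.algebraMap_eq]
  | add p q hp hq => simp [hp, hq, add_mul, Finset.sum_add_distrib]
  | mul_X p n hp =>
    simp only [map_mul, aeval_X, Polynomial.derivative_mul, hp, Derivation.leibniz, pderiv_X,
      smul_eq_mul, map_add, add_mul, Finset.sum_add_distrib]
    rw [add_comm]
    congr 1
    · rw [Finset.sum_eq_single n]
      · simp
      · intro j _ hj
        simp [hj.symm]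
      · simp
    · rw [Finset.sum_mul]
      exact Finset.sum_congr rfl fun i _ => by ring

theorem eval_shift (F : MvPolynomial (Fin 5) ℂ) (w : Fin 5 → ℂ)
    (hcone : ∑ i, MvPolynomial.C (w i) * MvPolynomial.pderiv i F = 0) (x : Fin 5 → ℂ) (t : ℂ) :
    eval (fun i => x i + t * w i) F = eval x F := by
  let g : Fin 5 → Polynomial ℂ := fun i => Polynomial.C (x i) + Polynomial.X * Polynomial.C (w i)
  have hd : Polynomial.derivative (MvPolynomial.aeval g F) = 0 := by
    rw [deriv_aeval]
    have := congrArg (MvPolynomial.aeval g) hcone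
    simp only [map_sum, map_mul, map_zero, aeval_C, Polynomial.algebraMap_eq] at this
    rw [← this]
    refine Finset.sum_congr rfl fun i _ => ?_
    have e : Polynomial.derivative (g i) = Polynomial.C (w i) := by simp [g]
    rw [e, mul_comm]
  have hev : ∀ s, Polynomial.eval s (MvPolynomial.aeval g F)
      = eval (fun i => x i + s * w i) F := by
    intro s
    rw [← Polynomial.coe_aeval_eq_eval, ← coe_aeval_eq_eval, RingHom.coe_coe,
      ← AlgHom.comp_apply, comp_aeval]
    simp [g]
    simp only [mul_comm s]
  have hc := Polynomial.eq_C_of_natDegree_eq_zero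
    (Polynomial.derivative_eq_zero.mp hd)
  have h0 := hev 0
  rw [← hev t, hc]
  rw [hc] at h0
  simpa using h0

theorem cone_cubic_pfaffian
    (F : MvPolynomial (Fin 5) ℂ) (hF : F.IsHomogeneous 3)
    (w : Fin 5 → ℂ) (hw : w ≠ 0)
    (hcone : ∑ i, MvPolynomial.C (w i) * MvPolynomial.pderiv i F = 0) :
    ∃ M : Matrix (Fin 6) (Fin 6) (MvPolynomial (Fin 5) ℂ),
      (∀ i j, (M i j).IsHomogeneous 1) ∧ Mᵀ = -M ∧ M.det = F ^ 2 := by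
  change IsPf F
  obtain ⟨k, hk⟩ := Function.ne_iff.mp hw
  simp only [Pi.zero_apply] at hk
  let g : Fin 5 → MvPolynomial (Fin 4) ℂ := k.insertNth 0 X
  have hg : ∀ i, (g i).IsHomogeneous 1 := by
    intro i
    refine Fin.succAboveCases k ?_ (fun j => ?_) i
    · simpa [g] using isHomogeneous_zero _ _ _
    · simpa [g] using isHomogeneous_X _ _
  have hG : IsPf (MvPolynomial.aeval g F) := isPf_four (by simpa using hF.aeval g hg)
  have := hG.aeval (fun j => X (k.succAbove j) - C (w (k.succAbove j) / w k) * X k)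
    fun j => (isHomogeneous_X _ _).sub (isHomogeneous_C_mul_X _ _)
  convert this using 1
  refine MvPolynomial.funext fun x => ?_
  rw [← eval_shift F w hcone x (- x k / w k)]
  rw [← coe_aeval_eq_eval, ← coe_aeval_eq_eval, RingHom.coe_coe, RingHom.coe_coe,
    ← AlgHom.comp_apply, ← AlgHom.comp_apply, AlgHom.comp_assoc, comp_aeval, comp_aeval]
  congr 2
  ext i
  refine Fin.succAboveCases k ?_ (fun j => ?_) i
  · simp [g]
    field_simp
    simp
  · simp [g]
    field_simp
    ring
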